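/- Let m, n ≥ 5, with N = m+n if m = n and N = m+n−1 if n ≥ m+1. Suppose a red/blue edge-coloring of K_{N,N} contains neither a blue C_{2n} nor a red C_{2m}. If n ≥ m+1, then the longest blue cycle has length at most 2(n−1). If n = m, then the longest blue cycle and the longest red cycle each have length at most 2(m−1). -/

import Mathlib

def hasCycleLength {V : Type*} (G : SimpleGraph V) (l : ℕ) : Prop :=
  ∃ (v : V) (p : G.Walk v v), p.IsCycle ∧ p.length = l

theorem hasCycleLength_of_isChain {V : Type*} {G : SimpleGraph V} {l : List V} (hl : l.Nodup)
    (h3 : 3 ≤ l.length) (hc : l.IsChain G.Adj)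
    (hclose : ∀ x ∈ l.getLast?, ∀ y ∈ l.head?, G.Adj x y) : hasCycleLength G l.length := by
  have hne : l ≠ [] := by rintro rfl; simp at h3
  have hadj : G.Adj (l.getLast hne) (l.head hne) :=
    hclose _ (List.getLast?_eq_some_getLast hne) _ (List.head?_eq_some_head hne)
  have hlen := SimpleGraph.Walk.length_ofSupport hne hc
  refine ⟨_, .cons hadj (.ofSupport l hne hc), ?_, ?_⟩
  · rw [SimpleGraph.Walk.isCycle_iff_isPath_tail_and_le_length]
    refine ⟨?_, by rw [SimpleGraph.Walk.length_cons]; lia⟩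
    simp [SimpleGraph.Walk.isPath_def, SimpleGraph.Walk.support_ofSupport, hl]
  · rw [SimpleGraph.Walk.length_cons]; lia

theorem hasCycleLength_of_isChain_comp {V ι : Type*} {G : SimpleGraph V} {p : ι → V} {s : Set ι}
    (hp : s.InjOn p) {l : List ι} (hls : ∀ i ∈ l, i ∈ s) (hl : l.Nodup) (h3 : 3 ≤ l.length)
    (hc : l.IsChain fun i j => G.Adj (p i) (p j))
    (hclose : ∀ i ∈ l.getLast?, ∀ j ∈ l.head?, G.Adj (p i) (p j)) :
    hasCycleLength G l.length := by
  rw [← l.length_map (f := p)]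
  refine hasCycleLength_of_isChain ?_ (by simpa using h3)
    (List.isChain_map_of_isChain p (fun _ _ h => h) hc) ?_
  · exact hl.map_on fun i hi j hj h => hp (hls i hi) (hls j hj) h
  · simpa using hclose

/-- The arithmetic progression `i, i + 3, i + 6, …` with `c` terms, possibly reversed. -/
def strand (c : ℕ → ℕ) (a : ℕ × Bool) : List ℕ :=
  if a.2 then (List.range (c a.1)).map (a.1 + 3 * ·)
  else ((List.range (c a.1)).map (a.1 + 3 * ·)).reverse

def strandFirst (c : ℕ → ℕ) (a : ℕ × Bool) : ℕ := if a.2 then a.1 else a.1 + 3 * (c a.1 - 1)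

def strandLast (c : ℕ → ℕ) (a : ℕ × Bool) : ℕ := if a.2 then a.1 + 3 * (c a.1 - 1) else a.1

section strand

variable {c : ℕ → ℕ}

theorem length_strand (a : ℕ × Bool) : (strand c a).length = c a.1 := by
  unfold strand; split <;> simp

theorem mem_strand {a : ℕ × Bool} {i : ℕ} : i ∈ strand c a ↔ ∃ k < c a.1, a.1 + 3 * k = i := by
  unfold strand; split <;> simp

theorem nodup_strand (a : ℕ × Bool) : (strand c a).Nodup := by
  have : ((List.range (c a.1)).map (a.1 + 3 * ·)).Nodup :=
    List.nodup_range.map fun x y h => by simpa using h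
  unfold strand; split
  · exact this
  · exact List.nodup_reverse.2 this

theorem head?_strand {a : ℕ × Bool} (ha : 0 < c a.1) :
    (strand c a).head? = some (strandFirst c a) := by
  have : c a.1 ≠ 0 := ha.ne'
  unfold strand strandFirst; split <;> simp [List.head?_range, List.getLast?_range, this]

theorem getLast?_strand {a : ℕ × Bool} (ha : 0 < c a.1) :
    (strand c a).getLast? = some (strandLast c a) := by
  have : c a.1 ≠ 0 := ha.ne'
  unfold strand strandLast; split <;> simp [List.head?_range, List.getLast?_range, this]

theorem isChain_strand {R : ℕ → ℕ → Prop} (hR : ∀ i j, R i j → R j i) {a : ℕ × Bool}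
    (h : ∀ k, k + 1 < c a.1 → R (a.1 + 3 * k) (a.1 + 3 * (k + 1))) :
    (strand c a).IsChain R := by
  have : ((List.range (c a.1)).map (a.1 + 3 * ·)).IsChain R := by
    rw [List.isChain_map, List.isChain_range]
    intro k hk
    exact h k (by lia)
  unfold strand; split
  · exact this
  · rw [List.isChain_reverse]
    exact this.imp fun i j => hR i j

end strand

/-- If the first nine strands are single points and the strands in `l` are distinct, then
a cyclic arrangement of strands whose ends are joined yields a cycle. -/
theorem hasCycleLength_of_strands {V : Type*} {G : SimpleGraph V} {p : ℕ → V} {L : ℕ}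
    (hp : (Set.Iio L).InjOn p) {c : ℕ → ℕ} (hc1 : ∀ i < 9, c i = 1) (hc0 : ∀ i, 0 < c i)
    (hcL : ∀ i < 12, ∀ k < c i, i + 3 * k < L)
    (hstep : ∀ i, i + 3 < L → G.Adj (p i) (p (i + 3)))
    {l : List (ℕ × Bool)} (hl12 : ∀ a ∈ (0, true) :: l, a.1 < 12)
    (hl : (((0, true) :: l).map Prod.fst).Nodup) (h3 : 2 ≤ l.length)
    (hchain : ((0, true) :: l ++ [(0, true)]).IsChain
      fun a b => G.Adj (p (strandLast c a)) (p (strandFirst c b))) :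
    hasCycleLength G (((0, true) :: l).map fun a => c a.1).sum := by
  have h0 : strand c (0, true) = [0] := by simp [strand, hc1]
  have hlen : ((((0, true) :: l).map (strand c)).flatten).length =
      (((0, true) :: l).map fun a => c a.1).sum := by
    rw [List.length_flatten, List.map_map]
    congr 1
    exact List.map_congr_left fun a _ => length_strand a
  have hch : ((((0, true) :: l ++ [(0, true)]).map (strand c)).flatten).IsChain
      fun i j => G.Adj (p i) (p j) := by
    rw [List.isChain_flatten]
    · refine ⟨?_, ?_⟩
      · intro s hs
        obtain ⟨a, ha, rfl⟩ := List.mem_map.1 hs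
        have ha : a.1 < 12 := hl12 a (by grind)
        refine isChain_strand (fun _ _ h => h.symm) fun k hk => hstep _ ?_
        exact hcL _ ha (k + 1) hk
      · rw [List.isChain_map]
        refine hchain.imp fun a b h => ?_
        simpa [head?_strand (hc0 _), getLast?_strand (hc0 _)] using h
    · intro h
      obtain ⟨a, -, ha⟩ := List.mem_map.1 h
      have := length_strand (c := c) a
      rw [ha] at this
      exact (hc0 a.1).ne this
  rw [List.map_append, List.flatten_append, List.isChain_append] at hch
  rw [← hlen]
  refine hasCycleLength_of_isChain_comp hp ?_ ?_ ?_ hch.1 ?_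
  · intro i hi
    obtain ⟨s, hs, hi⟩ := List.mem_flatten.1 hi
    obtain ⟨a, ha, rfl⟩ := List.mem_map.1 hs
    obtain ⟨k, hk, rfl⟩ := mem_strand.1 hi
    exact hcL _ (hl12 a ha) k hk
  · rw [List.nodup_flatten]
    refine ⟨?_, ?_⟩
    · intro s hs
      obtain ⟨a, -, rfl⟩ := List.mem_map.1 hs
      exact nodup_strand a
    · rw [List.pairwise_map]
      rw [List.nodup_iff_pairwise_ne, List.pairwise_map] at hl
      refine hl.imp_of_mem fun {a b} ha hb hab i hia hib => ?_
      obtain ⟨k, hk, rfl⟩ := mem_strand.1 hia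
      obtain ⟨k', hk', hkk⟩ := mem_strand.1 hib
      have := hl12 a ha
      have := hl12 b hb
      by_cases ha9 : a.1 < 9
      · rw [hc1 _ ha9] at hk
        by_cases hb9 : b.1 < 9
        · rw [hc1 _ hb9] at hk'
          lia
        · lia
      · by_cases hb9 : b.1 < 9
        · rw [hc1 _ hb9] at hk'
          lia
        · lia
  · rw [hlen]
    have : ∀ l : List (ℕ × Bool), l.length ≤ (l.map fun a => c a.1).sum := by
      intro l
      induction l with
      | nil => simp
      | cons a l ih => have := hc0 a.1; simp; lia
    have := this ((0, true) :: l)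
    simp only [List.length_cons] at this
    lia
  · have := hch.2.2
    simpa [h0] using this

/-- The number of terms of the strand starting at `i`: a single one if `i < 9`, and as many as
fit below `L` if `i` is `9`, `10` or `11`. -/
def strandLength (L i : ℕ) : ℕ := if i < 9 then 1 else (L - 1 - i) / 3 + 1

theorem strandLength_of_lt {L i : ℕ} (hi : i < 9) : strandLength L i = 1 := by
  simp [strandLength, hi]

/-- A sequence `p` of `L` distinct vertices, adjacent at distance three, such that of any two
parallel pairs among the first twelve vertices at least one is an edge. -/
structure Ladder {V : Type*} (G : SimpleGraph V) (p : ℕ → V) (L : ℕ) : Prop where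
  le : 12 ≤ L
  inj : (Set.Iio L).InjOn p
  step : ∀ i, i + 3 < L → G.Adj (p i) (p (i + 3))
  window : ∀ i j x y, 1 ≤ x ∧ 1 ≤ y ∧ x + y = 4 ∧ i + 3 ≤ j ∧ j + y ≤ 11 ∧ (i + j) % 2 = 1 →
    G.Adj (p i) (p j) ∨ G.Adj (p (i + x)) (p (j + y))

namespace Ladder

variable {V : Type*} {G : SimpleGraph V} {p : ℕ → V} {L : ℕ}

theorem adj_add_three (h : Ladder G p L) :
    G.Adj (p 0) (p 3) ∧ G.Adj (p 1) (p 4) ∧ G.Adj (p 2) (p 5) ∧ G.Adj (p 3) (p 6) ∧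
      G.Adj (p 4) (p 7) ∧ G.Adj (p 5) (p 8) ∧ G.Adj (p 6) (p 9) ∧ G.Adj (p 7) (p 10) ∧
      G.Adj (p 8) (p 11) := by
  have hL := h.le
  and_intros <;> exact h.step _ (by lia)

theorem hasCycleLength_of_items (h : Ladder G p L) (l : List (ℕ × Bool))
    (hl12 : ∀ a ∈ (0, true) :: l, a.1 < 12)
    (hl : (((0, true) :: l).map Prod.fst).Nodup) (h3 : 2 ≤ l.length)
    (hsum : (((0, true) :: l).map fun a => strandLength L a.1).sum =
      7 + strandLength L 9 + strandLength L 10 + strandLength L 11)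
    (hchain : ((0, true) :: l ++ [(0, true)]).IsChain fun a b =>
      G.Adj (p (strandLast (strandLength L) a)) (p (strandFirst (strandLength L) b))) :
    hasCycleLength G (L - 2) := by
  have hL := h.le
  have := hasCycleLength_of_strands h.inj (fun i hi => by simp [strandLength, hi])
    (fun i => by unfold strandLength; split <;> lia)
    (fun i hi k hk => by unfold strandLength at hk; split at hk <;> lia) h.step hl12 hl h3 hchain
  rw [hsum] at this
  convert this using 1
  simp [strandLength]
  lia

theorem hasCycleLength_of_links_012 (h : Ladder G p L)
    (h9 : G.Adj (p (9 + 3 * (strandLength L 9 - 1))) (p 0))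
    (h10 : G.Adj (p (10 + 3 * (strandLength L 10 - 1))) (p 1))
    (h11 : G.Adj (p (11 + 3 * (strandLength L 11 - 1))) (p 2)) :
    hasCycleLength G (L - 2) := by
  obtain ⟨s0, s1, s2, s3, s4, s5, s6, s7, s8⟩ := h.adj_add_three
  by_cases e3_8 : G.Adj (p 3) (p 8)
  · by_cases e2_7 : G.Adj (p 2) (p 7)
    · by_cases e4_9 : G.Adj (p 4) (p 9)
      · exact h.hasCycleLength_of_items
          [(9, false), (4, true), (1, true), (10, false), (7, true),
           (2, true), (11, false), (8, true), (3, true)]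
          (by simp) (by simp) (by simp) (by simp [strandLength_of_lt]; lia)
          (by simp [strandFirst, strandLast, strandLength_of_lt]; grind [SimpleGraph.adj_comm])
      · have e6_11 : G.Adj (p 6) (p 11) := (h.window 4 9 2 2 (by decide)).resolve_left e4_9
        have e1_8 : G.Adj (p 1) (p 8) := (h.window 1 8 3 1 (by decide)).resolve_right e4_9
        exact h.hasCycleLength_of_items
          [(9, false), (6, true), (11, true), (2, true), (7, true),
           (10, true), (1, true), (8, true), (3, true)]
          (by simp) (by simp) (by simp) (by simp [strandLength_of_lt]; lia)
          (by simp [strandFirst, strandLast, strandLength_of_lt]; grind [SimpleGraph.adj_comm])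
    · have e4_9 : G.Adj (p 4) (p 9) := (h.window 2 7 2 2 (by decide)).resolve_left e2_7
      have e3_10 : G.Adj (p 3) (p 10) := (h.window 2 7 1 3 (by decide)).resolve_left e2_7
      have e0_5 : G.Adj (p 0) (p 5) := (h.window 0 5 2 2 (by decide)).resolve_right e2_7
      exact h.hasCycleLength_of_items
        [(9, false), (4, true), (1, true), (10, false), (3, true),
         (8, true), (11, true), (2, true), (5, true)]
        (by simp) (by simp) (by simp) (by simp [strandLength_of_lt]; lia)
        (by simp [strandFirst, strandLast, strandLength_of_lt]; grind [SimpleGraph.adj_comm])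
  · have e1_6 : G.Adj (p 1) (p 6) := (h.window 1 6 2 2 (by decide)).resolve_right e3_8
    have e5_10 : G.Adj (p 5) (p 10) := (h.window 3 8 2 2 (by decide)).resolve_left e3_8
    have e4_11 : G.Adj (p 4) (p 11) := (h.window 3 8 1 3 (by decide)).resolve_left e3_8
    have e0_7 : G.Adj (p 0) (p 7) := (h.window 0 7 3 1 (by decide)).resolve_right e3_8
    exact h.hasCycleLength_of_items
      [(9, false), (6, true), (1, true), (10, false), (5, true),
       (2, true), (11, false), (4, true), (7, true)]
      (by simp) (by simp) (by simp) (by simp [strandLength_of_lt]; lia)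
      (by simp [strandFirst, strandLast, strandLength_of_lt]; grind [SimpleGraph.adj_comm])

theorem hasCycleLength_of_links_021 (h : Ladder G p L)
    (h9 : G.Adj (p (9 + 3 * (strandLength L 9 - 1))) (p 0))
    (h10 : G.Adj (p (10 + 3 * (strandLength L 10 - 1))) (p 2))
    (h11 : G.Adj (p (11 + 3 * (strandLength L 11 - 1))) (p 1)) :
    hasCycleLength G (L - 2) := by
  obtain ⟨s0, s1, s2, s3, s4, s5, s6, s7, s8⟩ := h.adj_add_three
  by_cases e2_9 : G.Adj (p 2) (p 9)
  · by_cases e3_8 : G.Adj (p 3) (p 8)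
    · exact h.hasCycleLength_of_items
        [(9, false), (2, true), (10, false), (7, true), (4, true),
         (1, true), (11, false), (8, true), (3, true)]
        (by simp) (by simp) (by simp) (by simp [strandLength_of_lt]; lia)
        (by simp [strandFirst, strandLast, strandLength_of_lt]; grind [SimpleGraph.adj_comm])
    · have e1_6 : G.Adj (p 1) (p 6) := (h.window 1 6 2 2 (by decide)).resolve_right e3_8
      have e0_7 : G.Adj (p 0) (p 7) := (h.window 0 7 3 1 (by decide)).resolve_right e3_8
      exact h.hasCycleLength_of_items
        [(9, false), (6, true), (1, true), (11, false), (8, true),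
         (5, true), (2, true), (10, false), (7, true)]
        (by simp) (by simp) (by simp) (by simp [strandLength_of_lt]; lia)
        (by simp [strandFirst, strandLast, strandLength_of_lt]; grind [SimpleGraph.adj_comm])
  · have e1_6 : G.Adj (p 1) (p 6) := (h.window 1 6 1 3 (by decide)).resolve_right e2_9
    have e0_7 : G.Adj (p 0) (p 7) := (h.window 0 7 2 2 (by decide)).resolve_right e2_9
    exact h.hasCycleLength_of_items
      [(9, false), (6, true), (1, true), (11, false), (8, true),
       (5, true), (2, true), (10, false), (7, true)]
      (by simp) (by simp) (by simp) (by simp [strandLength_of_lt]; lia)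
      (by simp [strandFirst, strandLast, strandLength_of_lt]; grind [SimpleGraph.adj_comm])

theorem hasCycleLength_of_links_102 (h : Ladder G p L)
    (h9 : G.Adj (p (9 + 3 * (strandLength L 9 - 1))) (p 1))
    (h10 : G.Adj (p (10 + 3 * (strandLength L 10 - 1))) (p 0))
    (h11 : G.Adj (p (11 + 3 * (strandLength L 11 - 1))) (p 2)) :
    hasCycleLength G (L - 2) := by
  obtain ⟨s0, s1, s2, s3, s4, s5, s6, s7, s8⟩ := h.adj_add_three
  by_cases e2_9 : G.Adj (p 2) (p 9)
  · by_cases e3_8 : G.Adj (p 3) (p 8)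
    · exact h.hasCycleLength_of_items
        [(10, false), (7, true), (4, true), (1, true), (9, false),
         (2, true), (11, false), (8, true), (3, true)]
        (by simp) (by simp) (by simp) (by simp [strandLength_of_lt]; lia)
        (by simp [strandFirst, strandLast, strandLength_of_lt]; grind [SimpleGraph.adj_comm])
    · have e5_10 : G.Adj (p 5) (p 10) := (h.window 3 8 2 2 (by decide)).resolve_left e3_8
      have e4_11 : G.Adj (p 4) (p 11) := (h.window 3 8 1 3 (by decide)).resolve_left e3_8
      exact h.hasCycleLength_of_items
        [(10, false), (5, true), (2, true), (11, false), (4, true),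
         (1, true), (9, false), (6, true), (3, true)]
        (by simp) (by simp) (by simp) (by simp [strandLength_of_lt]; lia)
        (by simp [strandFirst, strandLast, strandLength_of_lt]; grind [SimpleGraph.adj_comm])
  · have e5_10 : G.Adj (p 5) (p 10) := (h.window 2 9 3 1 (by decide)).resolve_left e2_9
    have e4_11 : G.Adj (p 4) (p 11) := (h.window 2 9 2 2 (by decide)).resolve_left e2_9
    exact h.hasCycleLength_of_items
      [(10, false), (5, true), (2, true), (11, false), (4, true),
       (1, true), (9, false), (6, true), (3, true)]
      (by simp) (by simp) (by simp) (by simp [strandLength_of_lt]; lia)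
      (by simp [strandFirst, strandLast, strandLength_of_lt]; grind [SimpleGraph.adj_comm])

theorem hasCycleLength_of_links_120 (h : Ladder G p L)
    (h9 : G.Adj (p (9 + 3 * (strandLength L 9 - 1))) (p 1))
    (h10 : G.Adj (p (10 + 3 * (strandLength L 10 - 1))) (p 2))
    (h11 : G.Adj (p (11 + 3 * (strandLength L 11 - 1))) (p 0)) :
    hasCycleLength G (L - 2) := by
  obtain ⟨s0, s1, s2, s3, s4, s5, s6, s7, s8⟩ := h.adj_add_three
  by_cases e0_9 : G.Adj (p 0) (p 9)
  · exact h.hasCycleLength_of_items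
      [(11, false), (8, true), (5, true), (2, true), (10, false),
       (7, true), (4, true), (1, true), (9, false)]
      (by simp) (by simp) (by simp) (by simp [strandLength_of_lt]; lia)
      (by simp [strandFirst, strandLast, strandLength_of_lt]; grind [SimpleGraph.adj_comm])
  · have e2_11 : G.Adj (p 2) (p 11) := (h.window 0 9 2 2 (by decide)).resolve_left e0_9
    exact h.hasCycleLength_of_items
      [(11, false), (2, true), (10, false), (7, true), (4, true),
       (1, true), (9, false), (6, true), (3, true)]
      (by simp) (by simp) (by simp) (by simp [strandLength_of_lt]; lia)
      (by simp [strandFirst, strandLast, strandLength_of_lt]; grind [SimpleGraph.adj_comm])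

theorem hasCycleLength_of_links_201 (h : Ladder G p L)
    (h9 : G.Adj (p (9 + 3 * (strandLength L 9 - 1))) (p 2))
    (h10 : G.Adj (p (10 + 3 * (strandLength L 10 - 1))) (p 0))
    (h11 : G.Adj (p (11 + 3 * (strandLength L 11 - 1))) (p 1)) :
    hasCycleLength G (L - 2) := by
  obtain ⟨s0, s1, s2, s3, s4, s5, s6, s7, s8⟩ := h.adj_add_three
  by_cases e0_9 : G.Adj (p 0) (p 9)
  · exact h.hasCycleLength_of_items
      [(10, false), (7, true), (4, true), (1, true), (11, false),
       (8, true), (5, true), (2, true), (9, false)]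
      (by simp) (by simp) (by simp) (by simp [strandLength_of_lt]; lia)
      (by simp [strandFirst, strandLast, strandLength_of_lt]; grind [SimpleGraph.adj_comm])
  · have e2_11 : G.Adj (p 2) (p 11) := (h.window 0 9 2 2 (by decide)).resolve_left e0_9
    exact h.hasCycleLength_of_items
      [(10, false), (7, true), (4, true), (1, true), (11, false),
       (2, true), (9, false), (6, true), (3, true)]
      (by simp) (by simp) (by simp) (by simp [strandLength_of_lt]; lia)
      (by simp [strandFirst, strandLast, strandLength_of_lt]; grind [SimpleGraph.adj_comm])

theorem hasCycleLength_of_links_210 (h : Ladder G p L)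
    (h9 : G.Adj (p (9 + 3 * (strandLength L 9 - 1))) (p 2))
    (h10 : G.Adj (p (10 + 3 * (strandLength L 10 - 1))) (p 1))
    (h11 : G.Adj (p (11 + 3 * (strandLength L 11 - 1))) (p 0)) :
    hasCycleLength G (L - 2) := by
  obtain ⟨s0, s1, s2, s3, s4, s5, s6, s7, s8⟩ := h.adj_add_three
  by_cases e1_8 : G.Adj (p 1) (p 8)
  · by_cases e2_7 : G.Adj (p 2) (p 7)
    · exact h.hasCycleLength_of_items
        [(11, false), (8, true), (1, true), (10, false), (7, true),
         (2, true), (9, false), (6, true), (3, true)]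
        (by simp) (by simp) (by simp) (by simp [strandLength_of_lt]; lia)
        (by simp [strandFirst, strandLast, strandLength_of_lt]; grind [SimpleGraph.adj_comm])
    · have e4_9 : G.Adj (p 4) (p 9) := (h.window 2 7 2 2 (by decide)).resolve_left e2_7
      have e3_10 : G.Adj (p 3) (p 10) := (h.window 2 7 1 3 (by decide)).resolve_left e2_7
      exact h.hasCycleLength_of_items
        [(11, false), (8, true), (5, true), (2, true), (9, false),
         (4, true), (1, true), (10, false), (3, true)]
        (by simp) (by simp) (by simp) (by simp [strandLength_of_lt]; lia)
        (by simp [strandFirst, strandLast, strandLength_of_lt]; grind [SimpleGraph.adj_comm])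
  · have e4_9 : G.Adj (p 4) (p 9) := (h.window 1 8 3 1 (by decide)).resolve_left e1_8
    have e3_10 : G.Adj (p 3) (p 10) := (h.window 1 8 2 2 (by decide)).resolve_left e1_8
    exact h.hasCycleLength_of_items
      [(11, false), (8, true), (5, true), (2, true), (9, false),
       (4, true), (1, true), (10, false), (3, true)]
      (by simp) (by simp) (by simp) (by simp [strandLength_of_lt]; lia)
      (by simp [strandFirst, strandLast, strandLength_of_lt]; grind [SimpleGraph.adj_comm])

end Ladder
theorem Ladder.hasCycleLength {V : Type*} {G : SimpleGraph V} {p : ℕ → V} {L : ℕ}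
    (h : Ladder G p L) (hlink : (∀ u < 3, G.Adj (p (L - 3 + u)) (p u)) ∨
      ∀ u < 3, G.Adj (p (L - 3 + u)) (p (2 - u))) : _root_.hasCycleLength G (L - 2) := by
  have hL := h.le
  have top (r : ℕ) (hr : r < 3) : ∃ u < 3, (L + u) % 3 = r ∧
      9 + r + 3 * (strandLength L (9 + r) - 1) = L - 3 + u := by
    refine ⟨(r + 2 * L) % 3, Nat.mod_lt _ (by lia), by lia, ?_⟩
    simp [strandLength]
    lia
  obtain ⟨u, hu, hur, e9⟩ := top 0 (by lia)
  obtain ⟨u', hu', hur', e10⟩ := top 1 (by lia)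
  obtain ⟨u'', hu'', hur'', e11⟩ := top 2 (by lia)
  simp only [Nat.add_zero, Nat.reduceAdd] at e9 e10 e11
  rcases hlink with hl | hl
  all_goals
    have l9 := hl u hu
    have l10 := hl u' hu'
    have l11 := hl u'' hu''
    rw [← e9] at l9
    rw [← e10] at l10
    rw [← e11] at l11
    obtain h0 | h0 | h0 : L % 3 = 0 ∨ L % 3 = 1 ∨ L % 3 = 2 := by lia
  · obtain ⟨rfl, rfl, rfl⟩ : u = 0 ∧ u' = 1 ∧ u'' = 2 := by lia
    exact h.hasCycleLength_of_links_012 l9 l10 l11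
  · obtain ⟨rfl, rfl, rfl⟩ : u = 2 ∧ u' = 0 ∧ u'' = 1 := by lia
    exact h.hasCycleLength_of_links_201 l9 l10 l11
  · obtain ⟨rfl, rfl, rfl⟩ : u = 1 ∧ u' = 2 ∧ u'' = 0 := by lia
    exact h.hasCycleLength_of_links_120 l9 l10 l11
  · obtain ⟨rfl, rfl, rfl⟩ : u = 0 ∧ u' = 1 ∧ u'' = 2 := by lia
    exact h.hasCycleLength_of_links_210 l9 l10 l11
  · obtain ⟨rfl, rfl, rfl⟩ : u = 2 ∧ u' = 0 ∧ u'' = 1 := by lia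
    exact h.hasCycleLength_of_links_021 l9 l10 l11
  · obtain ⟨rfl, rfl, rfl⟩ : u = 1 ∧ u' = 2 ∧ u'' = 0 := by lia
    exact h.hasCycleLength_of_links_102 l9 l10 l11

/-- A cycle of length `T`, unrolled to a `T`-periodic sequence of vertices. -/
structure IsPeriodicCycle {V : Type*} (G : SimpleGraph V) (v : ℕ → V) (T : ℕ) : Prop where
  three_le : 3 ≤ T
  periodic : ∀ i, v (i + T) = v i
  adj : ∀ i, G.Adj (v i) (v (i + 1))
  injOn : ∀ i, (Set.Ico i (i + T)).InjOn v

theorem exists_isPeriodicCycle {V : Type*} {G : SimpleGraph V} {T : ℕ}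
    (h : hasCycleLength G T) : ∃ v, IsPeriodicCycle G v T := by
  obtain ⟨w, p, hp, rfl⟩ := h
  have h3 := hp.three_le_length
  refine ⟨fun i => p.getVert (i % p.length), h3, fun i => by simp, fun i => ?_, ?_⟩
  · have hi : i % p.length < p.length := Nat.mod_lt _ (by lia)
    have := p.adj_getVert_succ hi
    by_cases he : i % p.length + 1 = p.length
    · have h0 : (i + 1) % p.length = 0 := by
        rw [Nat.add_mod, Nat.mod_eq_of_lt (by lia : 1 < p.length), he, Nat.mod_self]
      rw [he, SimpleGraph.Walk.getVert_length] at this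
      simpa [h0] using this
    · have h0 : (i + 1) % p.length = i % p.length + 1 := by
        rw [Nat.add_mod, Nat.mod_eq_of_lt (by lia : 1 < p.length), Nat.mod_eq_of_lt (by lia)]
      simpa [h0] using this
  · intro i j hj k hk hjk
    have hj' : j % p.length < p.length := Nat.mod_lt _ (by lia)
    have hk' : k % p.length < p.length := Nat.mod_lt _ (by lia)
    have : j % p.length = k % p.length :=
      hp.getVert_injOn' (by simp only [Set.mem_ofPred_eq]; lia)
        (by simp only [Set.mem_ofPred_eq]; lia) hjk
    exact Nat.ModEq.eq_of_abs_lt this (by simp only [Set.mem_Ico] at hj hk; grind)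

namespace IsPeriodicCycle

variable {V : Type*} {G : SimpleGraph V} {v : ℕ → V} {T : ℕ}

theorem isChain_range' (h : IsPeriodicCycle G v T) (i n : ℕ) :
    (List.range' i n).IsChain fun a b => G.Adj (v a) (v b) :=
  (List.isChain_range' i n 1).imp fun a b (hab : b = a + 1) => hab ▸ h.adj a

theorem hasCycleLength_of_chord (h : IsPeriodicCycle G v T) (hT : 5 ≤ T) {i : ℕ}
    (hi : G.Adj (v i) (v (i + 3))) : hasCycleLength G (T - 2) := by
  rw [← List.length_range' (s := i + 3) (n := T - 2) (step := 1)]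
  refine hasCycleLength_of_isChain_comp (h.injOn (i + 1)) ?_ List.nodup_range' (by simp; lia)
    (h.isChain_range' _ _) ?_
  · intro a ha
    simp only [List.mem_range'_1, Set.mem_Ico] at ha ⊢
    lia
  · simp only [List.getLast?_range', List.head?_range']
    rw [if_neg (by lia), if_neg (by lia)]
    simp only [Option.mem_def, Option.some.injEq]
    rintro _ rfl _ rfl
    rw [show i + 3 + (T - 2) - 1 = i + T by lia, h.periodic]
    exact hi

theorem hasCycleLength_of_parallel_chords (h : IsPeriodicCycle G v T) {i j x y : ℕ} (hT : 5 ≤ T)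
    (hx : 1 ≤ x) (hy : 1 ≤ y) (hxy : x + y = 4) (hij : i + x ≤ j) (hji : j + y ≤ i + T)
    (hchord : G.Adj (v i) (v j)) (hchord' : G.Adj (v (i + x)) (v (j + y))) :
    hasCycleLength G (T - 2) := by
  have hlen : ((List.range' (i + x) (j - i - x + 1)).reverse ++
      List.range' (j + y) (i + T - j - y + 1)).length = T - 2 := by
    simp
    lia
  rw [← hlen]
  refine hasCycleLength_of_isChain_comp (h.injOn (i + 1)) ?_ ?_ (by lia) ?_ ?_
  · intro a ha
    simp only [List.mem_append, List.mem_reverse, List.mem_range'_1, Set.mem_Ico] at ha ⊢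
    lia
  · rw [List.nodup_append]
    refine ⟨List.nodup_reverse.2 List.nodup_range', List.nodup_range', fun a ha b hb => ?_⟩
    simp only [List.mem_reverse, List.mem_range'_1] at ha hb
    lia
  · rw [List.isChain_append, List.isChain_reverse]
    refine ⟨(h.isChain_range' _ _).imp fun a b hab => hab.symm, h.isChain_range' _ _, ?_⟩
    simpa [List.head?_range', List.getLast?_range'] using hchord'
  · have h1 : i + x + (j - i - x) = j := by lia
    have h2 : j + y + (i + T - j - y) = i + T := by lia
    simpa [List.head?_range', List.getLast?_range', h1, h2, h.periodic] using hchord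

theorem side_ne {side : V → Bool} (h : IsPeriodicCycle G v T)
    (hside : ∀ a b, G.Adj a b → side a ≠ side b) {i j : ℕ} (hij : (i + j) % 2 = 1) :
    side (v i) ≠ side (v j) := by
  have key (i : ℕ) : side (v i) = if i % 2 = 0 then side (v 0) else !side (v 0) := by
    induction i with
    | zero => simp
    | succ i ih =>
      rw [← Bool.not_eq.2 (hside _ _ (h.adj i)), Bool.not_eq_eq_eq_not]
      rw [ih]
      obtain hi | hi := Nat.mod_two_eq_zero_or_one i <;> simp [Nat.add_mod, hi]
  rw [key i, key j]
  obtain hi | hi := Nat.mod_two_eq_zero_or_one i <;>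
    simp [hi, show j % 2 = 1 - i % 2 by lia]

theorem even {side : V → Bool} (h : IsPeriodicCycle G v T)
    (hside : ∀ a b, G.Adj a b → side a ≠ side b) : T % 2 = 0 := by
  by_contra hT
  have := h.periodic 0
  exact h.side_ne hside (i := 0 + T) (j := 0) (by lia) (by rw [this])

theorem hasCycleLength_complement {red : SimpleGraph V} (h : IsPeriodicCycle G v T)
    (hcol : ∀ i j, (i + j) % 2 = 1 → red.Adj (v i) (v j) ∨ G.Adj (v i) (v j))
    (hT : ¬ hasCycleLength G (T - 2)) {k : ℕ} (hk : 5 ≤ k) (hkT : 2 * k + 2 ≤ T) :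
    hasCycleLength red (2 * k) := by
  have hpar (i j x y : ℕ) (hx : 1 ≤ x) (hy : 1 ≤ y) (hxy : x + y = 4) (hij : i + x ≤ j)
      (hji : j + y ≤ i + T) (hodd : (i + j) % 2 = 1) :
      red.Adj (v i) (v j) ∨ red.Adj (v (i + x)) (v (j + y)) := by
    by_contra! hne
    exact hT (h.hasCycleLength_of_parallel_chords (by lia) hx hy hxy hij hji
      ((hcol _ _ hodd).resolve_left hne.1) ((hcol _ _ (by lia)).resolve_left hne.2))
  have hladder (q : ℕ) : Ladder red (fun a => v (q + a)) (2 * k + 2) := by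
    refine ⟨by lia, ?_, ?_, ?_⟩
    · intro a ha b hb hab
      simp only [Set.mem_Iio] at ha hb
      have := h.injOn q (by simp only [Set.mem_Ico]; lia) (by simp only [Set.mem_Ico]; lia) hab
      lia
    · intro i _
      exact (hcol _ _ (by lia)).resolve_right fun hb =>
        hT (h.hasCycleLength_of_chord (by lia) (i := q + i) hb)
    · rintro i j x y ⟨hx, hy, hxy, hij, hj, hodd⟩
      have := hpar (q + i) (q + j) x y hx hy hxy (by lia) (by lia) (by lia)
      simpa only [Nat.add_assoc] using this
  by_cases hall : ∀ u < 3, red.Adj (v (2 * k + 2 - 3 + u)) (v u)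
  · exact (hladder 0).hasCycleLength (.inl (by simpa using hall))
  · push Not at hall
    obtain ⟨u, hu, hblue⟩ := hall
    refine (hladder (u + 1)).hasCycleLength (.inr fun w hw => ?_)
    have := (hpar u (2 * k + 2 - 3 + u) (3 - w) (1 + w) (by lia) (by lia) (by lia) (by lia)
      (by lia) (by lia)).resolve_left fun hr => hblue hr.symm
    convert this.symm using 2 <;> lia

end IsPeriodicCycle

theorem cycle_length_le {V : Type*} {red blue : SimpleGraph V} {side : V → Bool}
    (hside : ∀ a b, blue.Adj a b → side a ≠ side b)
    (hcol : ∀ a b, side a ≠ side b → red.Adj a b ∨ blue.Adj a b) {m n : ℕ} (hm : 5 ≤ m)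
    (hmn : m ≤ n) (hblue : ¬ hasCycleLength blue (2 * n)) (hred : ¬ hasCycleLength red (2 * m))
    {l : ℕ} (hl : hasCycleLength blue l) : l ≤ 2 * (n - 1) := by
  by_contra! hlt
  have heven : l % 2 = 0 := by
    obtain ⟨v, hv⟩ := exists_isPeriodicCycle hl
    exact hv.even hside
  have hex : ∃ d, hasCycleLength blue (2 * (n + d)) :=
    ⟨l / 2 - n, by rwa [show 2 * (n + (l / 2 - n)) = l by lia]⟩
  classical
  have hspec := Nat.find_spec hex
  have hd : Nat.find hex ≠ 0 := fun h0 => hblue (by simpa [h0] using hspec)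
  have hmin := Nat.find_min hex (m := Nat.find hex - 1) (by lia)
  obtain ⟨v, hv⟩ := exists_isPeriodicCycle hspec
  refine hred (hv.hasCycleLength_complement (fun i j hij => hcol _ _ (hv.side_ne hside hij))
    ?_ hm (by lia))
  rwa [show 2 * (n + Nat.find hex) - 2 = 2 * (n + (Nat.find hex - 1)) by lia]

/-- Let `m, n ≥ 5` with `N = m + n` if `m = n` and `N = m + n - 1` if `n ≥ m + 1`.
If a red/blue coloring of `K_{N,N}` has neither a blue `C_{2n}` nor a red `C_{2m}`,
then: if `n ≥ m + 1` every blue cycle has length at most `2(n-1)`, and if `n = m`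
every blue cycle and every red cycle has length at most `2(m-1)`. -/
theorem longest_cycle_bound (m n N : ℕ) (hm : 5 ≤ m) (hmn : m ≤ n)
    (hNeq : m = n → N = m + n) (hNlt : m + 1 ≤ n → N = m + n - 1)
    (red : SimpleGraph (Fin N ⊕ Fin N))
    (hred : red ≤ completeBipartiteGraph (Fin N) (Fin N))
    (hnoblue : ¬ hasCycleLength (completeBipartiteGraph (Fin N) (Fin N) \ red) (2 * n))
    (hnored : ¬ hasCycleLength red (2 * m)) :
    (m + 1 ≤ n →
      ∀ l : ℕ, hasCycleLength (completeBipartiteGraph (Fin N) (Fin N) \ red) l →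
        l ≤ 2 * (n - 1)) ∧
    (n = m →
      (∀ l : ℕ, hasCycleLength (completeBipartiteGraph (Fin N) (Fin N) \ red) l →
        l ≤ 2 * (m - 1)) ∧
      (∀ l : ℕ, hasCycleLength red l → l ≤ 2 * (m - 1))) := by
  have hmem (a b : Fin N ⊕ Fin N) :
      (completeBipartiteGraph (Fin N) (Fin N)).Adj a b ↔ a.isLeft ≠ b.isLeft := by
    cases a <;> cases b <;> simp
  have hcol (a b : Fin N ⊕ Fin N) (hab : a.isLeft ≠ b.isLeft) :
      red.Adj a b ∨ (completeBipartiteGraph (Fin N) (Fin N) \ red).Adj a b := by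
    rw [SimpleGraph.sdiff_adj, hmem]
    tauto
  have hblue (l : ℕ) (hl : hasCycleLength (completeBipartiteGraph (Fin N) (Fin N) \ red) l) :
      l ≤ 2 * (n - 1) :=
    cycle_length_le (fun a b h => (hmem a b).1 ((SimpleGraph.sdiff_adj _ _ a b).1 h).1) hcol
      hm hmn hnoblue hnored hl
  refine ⟨fun _ => hblue, ?_⟩
  rintro rfl
  exact ⟨hblue, fun l hl => cycle_length_le (fun a b h => (hmem a b).1 (hred h))
    (fun a b h => (hcol a b h).symm) hm le_rfl hnored hnoblue hl⟩
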